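/- arXiv:1202.3514 — 2 statements merged into one kernel-verified Lean document; each statement's English description precedes it below -/
import Mathlib

section
/- If p ≡ 1 (mod N₂), then for every β ∈ GF(r)*, the weight of the codeword c(β) in C(r,N) is divisible by q^{m/N₂ - 1} but not by q^{m/N₂} (i.e., q^{m/N₂ - 1} exactly divides wt(c(β))). -/
open scoped Classical

/-- The Hamming weight of the codeword `c(β) = (Tr_{r/q}(βθʲ))_{j=0}^{n-1}`. -/
noncomputable def codewordWeight (K F : Type) [Field K] [Field F] [Algebra K F]
    (θ : F) (n : ℕ) (β : F) : ℕ :=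
  (Finset.univ.filter fun j : Fin n => Algebra.trace K F (β * θ ^ (j : ℕ)) ≠ 0).card

section Valuation

/-- The fraction field of the Witt vectors over a field of characteristic `p` has an algebraically
closed extension carrying a valuation that is integral on Witt vectors and small at `p`. -/
theorem exists_valuation_algebraicClosure_wittVector (p : ℕ) [Fact p.Prime] (F : Type) [Field F]
    [CharP F p] [PerfectRing F p] :
    ∃ (B : ValuationSubring (AlgebraicClosure (FractionRing (WittVector p F))))
      (τ : WittVector p F →+* AlgebraicClosure (FractionRing (WittVector p F))),
      Function.Injective τ ∧ (∀ w, B.valuation (τ w) ≤ 1) ∧ B.valuation p < 1 := by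
  let Q := FractionRing (WittVector p F)
  let τ : WittVector p F →+* AlgebraicClosure Q :=
    (algebraMap Q (AlgebraicClosure Q)).comp (algebraMap (WittVector p F) Q)
  have hτ : Function.Injective τ :=
    (algebraMap Q (AlgebraicClosure Q)).injective.comp (IsFractionRing.injective (WittVector p F) Q)
  have hI : Ideal.span {(p : τ.range)} ≠ ⊤ := by
    rw [Ne, Ideal.span_singleton_eq_top]
    intro h
    obtain ⟨⟨_, w, rfl⟩, hw⟩ := isUnit_iff_exists_inv.mp h
    have h1 : τ ((p : WittVector p F) * w) = τ 1 := by
      have := congrArg Subtype.val hw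
      simpa using this
    exact (WittVector.irreducible p (k := F)).not_isUnit (IsUnit.of_mul_eq_one _ (hτ h1))
  obtain ⟨B, hB, hB'⟩ := Ideal.image_subset_nonunits_valuationSubring _ hI
  refine ⟨B, τ, hτ, fun w => ?_, ?_⟩
  · exact (B.valuation_le_one_iff _).2 (hB ⟨w, rfl⟩)
  · exact B.mem_nonunits_iff.1 (hB' ⟨(p : τ.range), Ideal.subset_span rfl, by simp⟩)

variable {L Γ : Type*} [Field L] [LinearOrderedCommGroupWithZero Γ] (v : Valuation L Γ)

theorem valuation_eq_one_of_pow_eq_one {x : L} {n : ℕ} (hn : n ≠ 0) (hx : x ^ n = 1) :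
    v x = 1 := by
  have : v x ^ n = 1 := by rw [← map_pow, hx, map_one]
  exact (pow_eq_one_iff_of_nonneg zero_le hn).1 this

theorem valuation_natCast_le_one (n : ℕ) : v (n : L) ≤ 1 := by
  induction n with
  | zero => simp
  | succ n ih => push_cast; exact v.map_add_le ih (by simp)

theorem valuation_natCast_eq_one {p : ℕ} (hp : p.Prime) (hvp : v (p : L) < 1) {n : ℕ}
    (hn : ¬ p ∣ n) : v (n : L) = 1 := by
  refine (valuation_natCast_le_one v n).antisymm (le_of_not_gt fun h => ?_)
  have hc : IsCoprime (p : ℤ) n := Nat.isCoprime_iff_coprime.2 ((hp.coprime_iff_not_dvd).2 hn)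
  obtain ⟨a, b, hab⟩ := hc
  have hz (a : ℤ) : v (a : L) ≤ 1 := by
    obtain ⟨m, rfl | rfl⟩ := a.eq_nat_or_neg
    · simpa using valuation_natCast_le_one v m
    · simpa using valuation_natCast_le_one v m
  have h1 : v (((a * p + b * n : ℤ)) : L) < 1 := by
    push_cast
    refine v.map_add_lt ?_ ?_
    · rw [map_mul]; exact mul_lt_one_of_nonneg_of_lt_one_right (hz a) zero_le hvp
    · rw [map_mul]; exact mul_lt_one_of_nonneg_of_lt_one_right (hz b) zero_le h
  rw [hab] at h1
  simp at h1

theorem valuation_one_sub_pow_le {ζ : L} (hζ : v ζ ≤ 1) (n : ℕ) : v (1 - ζ ^ n) ≤ v (1 - ζ) := by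
  rw [← mul_neg_geom_sum, map_mul]
  refine mul_le_of_le_one_right' (v.map_sum_le fun i _ => ?_)
  rw [map_pow]; exact pow_le_one' hζ i

/-- For a primitive `p`-th root of unity `ζ`, the valuation of `(1 - ζ)^(p-1)` is that of `p`. -/
theorem valuation_one_sub_pow_pred {p : ℕ} (hp : p.Prime) {ζ : L} (hζ : IsPrimitiveRoot ζ p) :
    v (1 - ζ) ^ (p - 1) = v (p : L) := by
  have hζ1 : v ζ = 1 := valuation_eq_one_of_pow_eq_one v hp.ne_zero hζ.pow_eq_one
  obtain ⟨n, rfl⟩ : ∃ n, p = n + 1 := ⟨p - 1, by have := hp.pos; omega⟩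
  have hprod := hζ.prod_one_sub_pow_eq_order
  push_cast
  rw [← hprod, map_prod, Finset.prod_eq_pow_card (b := v (1 - ζ)), Finset.card_range]
  intro i hi
  refine (valuation_one_sub_pow_le v hζ1.le _).antisymm ?_
  have hi : i < n := Finset.mem_range.1 hi
  have hco : (i + 1).Coprime (n + 1) :=
    (Nat.coprime_of_lt_prime (by omega) (by omega) hp).symm
  have hprim : IsPrimitiveRoot (ζ ^ (i + 1)) (n + 1) := hζ.pow_of_coprime _ hco
  obtain ⟨j, -, hj⟩ := hprim.eq_pow_of_pow_eq_one hζ.pow_eq_one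
  conv_lhs => rw [← hj]
  exact valuation_one_sub_pow_le v (by rw [map_pow, hζ1, one_pow]) j

theorem valuation_one_sub_lt_one {p : ℕ} (hp : p.Prime) (hvp : v (p : L) < 1) {ζ : L}
    (hζ : IsPrimitiveRoot ζ p) : v (1 - ζ) < 1 := by
  rw [← valuation_one_sub_pow_pred v hp hζ] at hvp
  exact lt_of_not_ge fun h => hvp.not_ge (one_le_pow_of_one_le' h _)

end Valuation

theorem Fintype.sum_eq_zero_add_sum_units {K M : Type*} [Field K] [Fintype K] [AddCommMonoid M]
    (f : K → M) : ∑ x, f x = f 0 + ∑ u : Kˣ, f u := by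
  rw [← Finset.add_sum_erase _ _ (Finset.mem_univ (0 : K))]
  congr 1
  symm
  exact Finset.sum_bij (fun u _ => (u : K)) (fun u _ => by simp) (fun _ _ _ _ h => Units.ext h)
    (fun x hx => ⟨Units.mk0 x (Finset.ne_of_mem_erase hx), Finset.mem_univ _, rfl⟩)
    fun _ _ => rfl

section GaussSum

variable {p : ℕ} [Fact p.Prime] {F : Type*} [Field F] {L : Type*} [Field L]

/-- The additive character `x ↦ ζ ^ Tr x` of a field of characteristic `p`. -/
noncomputable def traceChar [Algebra (ZMod p) F] {ζ : L} (hζ : ζ ^ p = 1) : AddChar F L :=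
  (AddChar.zmodChar p hζ).compAddMonoidHom (Algebra.trace (ZMod p) F).toAddMonoidHom

theorem traceChar_apply [Algebra (ZMod p) F] {ζ : L} (hζ : ζ ^ p = 1) (x : F) :
    traceChar hζ x = ζ ^ (Algebra.trace (ZMod p) F x).val := rfl

theorem traceChar_isPrimitive [Finite F] [Algebra (ZMod p) F] {ζ : L} (hζ : IsPrimitiveRoot ζ p) :
    (traceChar hζ.pow_eq_one : AddChar F L).IsPrimitive := by
  refine AddChar.IsPrimitive.of_ne_one fun h => ?_
  obtain ⟨a, ha⟩ := Algebra.trace_surjective (ZMod p) F 1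
  have h1 := DFunLike.congr_fun h a
  have : Fact (1 < p) := ⟨(Fact.out : p.Prime).one_lt⟩
  rw [traceChar_apply, ha, ZMod.val_one, pow_one] at h1
  exact hζ.ne_one (Fact.out : p.Prime).one_lt h1

theorem traceChar_pow_char [Fintype F] [Algebra (ZMod p) F] {ζ : L} (hζ : ζ ^ p = 1) (x : F) :
    traceChar hζ (x ^ p) = traceChar hζ x := by
  have : Algebra.trace (ZMod p) F (x ^ p) = Algebra.trace (ZMod p) F x := by
    have h := Algebra.trace_eq_of_algEquiv
      (FiniteField.frobeniusAlgEquivOfAlgebraic (ZMod p) F) x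
    rw [FiniteField.frobeniusAlgEquivOfAlgebraic_apply, ZMod.card] at h
    exact h
  rw [traceChar_apply, traceChar_apply, this]

theorem gaussSum_pow_char [Fintype F] [Algebra (ZMod p) F] {ζ : L} (hζ : ζ ^ p = 1)
    (χ : MulChar F L) : gaussSum (χ ^ p) (traceChar hζ) = gaussSum χ (traceChar hζ) := by
  have : CharP F p := charP_of_injective_algebraMap (algebraMap (ZMod p) F).injective p
  unfold gaussSum
  refine Fintype.sum_bijective (fun x : F => x ^ p) (bijective_frobenius F p) _ _ fun x => ?_
  rw [traceChar_pow_char, MulChar.pow_apply' _ (Fact.out : p.Prime).ne_zero, map_pow]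

theorem sum_inv_mul_trace [Fintype F] [Algebra (ZMod p) F] :
    ∑ x : F, x⁻¹ * algebraMap (ZMod p) F (Algebra.trace (ZMod p) F x) = -1 := by
  have hp : p.Prime := Fact.out
  have hcard : Fintype.card F = p ^ Module.finrank (ZMod p) F := by
    rw [Module.card_eq_pow_finrank (K := ZMod p), ZMod.card]
  have hk : 0 < Module.finrank (ZMod p) F := Module.finrank_pos
  have hsum (i : ℕ) : ∑ x : F, x⁻¹ * x ^ p ^ i =
      if Fintype.card F - 1 ∣ p ^ i - 1 then -1 else 0 := by
    rw [← FiniteField.sum_pow_units F (p ^ i - 1)]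
    rw [Fintype.sum_eq_zero_add_sum_units, inv_zero, zero_mul, zero_add]
    refine Finset.sum_congr rfl fun u _ => ?_
    obtain ⟨m, hm⟩ : ∃ m, p ^ i = m + 1 := ⟨p ^ i - 1, by have := pow_pos hp.pos i; omega⟩
    rw [hm, Nat.add_sub_cancel, pow_succ', inv_mul_cancel_left₀ u.ne_zero]
  simp_rw [FiniteField.algebraMap_trace_eq_sum_pow, Nat.card_eq_fintype_card, ZMod.card,
    Finset.mul_sum]
  rw [Finset.sum_comm, Finset.sum_eq_single_of_mem 0 (Finset.mem_range.2 hk)]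
  · rw [hsum]; simp
  · intro i hi hi0
    rw [hsum, if_neg]
    intro hdvd
    have h1 : p ^ i < p ^ Module.finrank (ZMod p) F :=
      Nat.pow_lt_pow_right hp.one_lt (Finset.mem_range.1 hi)
    have h2 : 1 < p ^ i := Nat.one_lt_pow hi0 hp.one_lt
    have := Nat.le_of_dvd (by omega) hdvd
    omega

/-- The Teichmüller character, transported along a ring homomorphism from the Witt vectors. -/
noncomputable def teichmullerChar (τ : WittVector p F →+* L) : MulChar F L where
  toFun x := τ (WittVector.teichmuller p x)
  map_one' := by simp
  map_mul' := by simp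
  map_nonunit' a ha := by
    have : a = 0 := by simpa using ha
    simp [this]

theorem teichmullerChar_apply (τ : WittVector p F →+* L) (x : F) :
    teichmullerChar τ x = τ (WittVector.teichmuller p x) := rfl

variable [CharP F p] {Γ : Type*} [LinearOrderedCommGroupWithZero Γ] {v : Valuation L Γ}
  {τ : WittVector p F →+* L}

theorem valuation_witt_eq_one (hτ : ∀ w, v (τ w) ≤ 1) {w : WittVector p F}
    (hw : WittVector.constantCoeff w ≠ 0) : v (τ w) = 1 := by
  obtain ⟨w', hw'⟩ := isUnit_iff_exists_inv.mp (WittVector.isUnit_of_coeff_zero_ne_zero w hw)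
  have h : v (τ w) * v (τ w') = 1 := by rw [← map_mul, ← map_mul, hw', map_one, map_one]
  refine (hτ w).antisymm ?_
  rw [← h]
  exact mul_le_of_le_one_right' (hτ w')

theorem teichmullerChar_injective (hτ : ∀ w, v (τ w) ≤ 1) :
    Function.Injective (teichmullerChar τ) := by
  intro x y hxy
  by_contra hne
  have h :
      WittVector.constantCoeff (WittVector.teichmuller p x - WittVector.teichmuller p y) ≠ 0 := by
    rw [map_sub, sub_ne_zero]
    simpa [WittVector.constantCoeff_apply, WittVector.teichmuller_coeff_zero] using hne
  have h1 := valuation_witt_eq_one hτ h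
  rw [map_sub, ← teichmullerChar_apply, ← teichmullerChar_apply, hxy, sub_self, map_zero] at h1
  exact zero_ne_one h1

theorem teichmullerChar_pow_eq_one_iff [Fintype F] (hτ : ∀ w, v (τ w) ≤ 1) (a : ℕ) :
    teichmullerChar τ ^ a = 1 ↔ Fintype.card F - 1 ∣ a := by
  have key : teichmullerChar τ ^ a = 1 ↔ ∀ x : Fˣ, x ^ a = 1 := by
    rw [MulChar.eq_one_iff]
    refine forall_congr' fun x => ?_
    rw [MulChar.pow_apply_coe, ← map_pow, ← (teichmullerChar τ).map_one,
      (teichmullerChar_injective hτ).eq_iff, Units.ext_iff]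
    simp
  rw [key]
  exact FiniteField.forall_pow_eq_one_iff F a

variable [Fintype F]

theorem valuation_mulChar_le_one (χ : MulChar F L) (x : F) : v (χ x) ≤ 1 := by
  by_cases hx : IsUnit x
  · obtain ⟨u, rfl⟩ := hx
    refine (valuation_eq_one_of_pow_eq_one v (Fintype.card_ne_zero (α := Fˣ)) ?_).le
    rw [← map_pow, ← Units.val_pow_eq_pow_val, pow_card_eq_one, Units.val_one, map_one]
  · rw [χ.map_nonunit hx, map_zero]; exact zero_le

theorem valuation_gaussSum_mul_le {χ φ : MulChar F L} (h : χ * φ ≠ 1) (ψ : AddChar F L) :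
    v (gaussSum χ ψ) * v (gaussSum φ ψ) ≤ v (gaussSum (χ * φ) ψ) := by
  rw [← map_mul, ← jacobiSum_mul_nontrivial h ψ, map_mul]
  refine mul_le_of_le_one_right' (v.map_sum_le fun x _ => ?_)
  rw [map_mul]
  exact mul_le_one' (valuation_mulChar_le_one χ x) (valuation_mulChar_le_one φ _)

theorem valuation_gaussSum_mul_inv {χ : MulChar F L} (hχ : χ ≠ 1) {ψ : AddChar F L}
    (hψ : ψ.IsPrimitive) :
    v (gaussSum χ ψ) * v (gaussSum χ⁻¹ ψ) = v (Fintype.card F : L) := by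
  rw [← gaussSum_mul_gaussSum_eq_card hχ hψ, map_mul, ← mul_gaussSum_inv_eq_gaussSum χ⁻¹ ψ,
    map_mul]
  have : v (χ⁻¹ (-1)) = 1 := by
    refine valuation_eq_one_of_pow_eq_one v two_ne_zero ?_
    rw [← map_pow]; simp
  rw [this, one_mul]

theorem teichmullerChar_inv_pow_eq_one_iff (hτ : ∀ w, v (τ w) ≤ 1) (a : ℕ) :
    (teichmullerChar τ)⁻¹ ^ a = 1 ↔ Fintype.card F - 1 ∣ a := by
  rw [inv_pow, inv_eq_one, teichmullerChar_pow_eq_one_iff hτ]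

theorem valuation_gaussSum_teichmullerChar_inv [Algebra (ZMod p) F] (hτ : ∀ w, v (τ w) ≤ 1)
    (hvp : v (p : L) < 1) {ζ : L} (hζ : IsPrimitiveRoot ζ p) (hF : 2 < Fintype.card F) :
    v (gaussSum (teichmullerChar τ)⁻¹ (traceChar hζ.pow_eq_one)) = v (1 - ζ) := by
  have hp : p.Prime := Fact.out
  set χ := (teichmullerChar τ)⁻¹ with hχ
  have hχ1 : χ ≠ 1 := by
    rw [← pow_one χ, Ne, teichmullerChar_inv_pow_eq_one_iff hτ, Nat.dvd_one]
    omega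
  let t (x : F) : ℕ := (Algebra.trace (ZMod p) F x).val
  have hG : gaussSum χ (traceChar hζ.pow_eq_one) =
      -((1 - ζ) * ∑ x, χ x * ∑ i ∈ Finset.range (t x), ζ ^ i) := by
    rw [gaussSum, ← sub_eq_zero, ← χ.sum_eq_zero_of_ne_one hχ1, Finset.mul_sum, sub_neg_eq_add,
      ← Finset.sum_add_distrib]
    refine Finset.sum_congr rfl fun x _ => ?_
    rw [mul_left_comm, mul_neg_geom_sum, traceChar_apply]
    ring
  have hW : v (∑ x, χ x * (t x : L)) = 1 := by
    have : ∑ x, χ x * (t x : L) =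
        τ (∑ x, WittVector.teichmuller p x⁻¹ * (t x : WittVector p F)) := by
      simp [hχ, MulChar.inv_apply', teichmullerChar_apply]
    rw [this]
    refine valuation_witt_eq_one hτ ?_
    have h2 : WittVector.constantCoeff
        (∑ x, WittVector.teichmuller p x⁻¹ * (t x : WittVector p F)) = -1 := by
      rw [← sum_inv_mul_trace (p := p), map_sum]
      refine Finset.sum_congr rfl fun x _ => ?_
      rw [map_mul, map_natCast, WittVector.constantCoeff_apply, WittVector.teichmuller_coeff_zero]
      congr 1
      conv_rhs => rw [← ZMod.natCast_zmod_val (Algebra.trace (ZMod p) F x), map_natCast]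
    rw [h2]
    exact neg_ne_zero.2 one_ne_zero
  have hζ1 : v ζ ≤ 1 := (valuation_eq_one_of_pow_eq_one v hp.ne_zero hζ.pow_eq_one).le
  have hdiff : v (∑ x, χ x * ∑ i ∈ Finset.range (t x), ζ ^ i - ∑ x, χ x * (t x : L)) < 1 := by
    rw [← Finset.sum_sub_distrib]
    refine v.map_sum_lt one_ne_zero fun x _ => ?_
    rw [← mul_sub, map_mul]
    refine mul_lt_one_of_nonneg_of_lt_one_right (valuation_mulChar_le_one χ x) zero_le ?_
    have : ∑ i ∈ Finset.range (t x), ζ ^ i - (t x : L) =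
        ∑ i ∈ Finset.range (t x), (ζ ^ i - 1) := by simp
    rw [this]
    refine v.map_sum_lt one_ne_zero fun i _ => ?_
    rw [v.map_sub_swap]
    exact (valuation_one_sub_pow_le v hζ1 i).trans_lt (valuation_one_sub_lt_one v hp hvp hζ)
  rw [hG, Valuation.map_neg, map_mul]
  have := v.map_add_eq_of_lt_right (hW ▸ hdiff)
  rw [sub_add_cancel, hW] at this
  rw [this, mul_one]

/-- One half of Stickelberger's theorem: the Gauss sum of the `a`-th power of the inverse
Teichmüller character is not more divisible by `1 - ζ` than the sum of the digits of `a`. -/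
theorem le_valuation_gaussSum [Algebra (ZMod p) F] (hτ : ∀ w, v (τ w) ≤ 1)
    (hvp : v (p : L) < 1) {ζ : L} (hζ : IsPrimitiveRoot ζ p) {a : ℕ} (ha : 0 < a)
    (ha' : a < Fintype.card F - 1) :
    v (1 - ζ) ^ (p.digits a).sum ≤
      v (gaussSum ((teichmullerChar τ)⁻¹ ^ a) (traceChar hζ.pow_eq_one)) := by
  have hp : p.Prime := Fact.out
  induction a using Nat.strong_induction_on with
  | _ a ih =>
  by_cases hpa : p ∣ a
  · obtain ⟨b, rfl⟩ := hpa
    have hb : 0 < b := Nat.pos_of_mul_pos_left ha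
    have hlt : b < p * b := by nlinarith [hp.two_le]
    have h := ih b hlt hb (by omega)
    rw [Nat.digits_def' hp.one_lt ha, Nat.mul_mod_right, Nat.mul_div_cancel_left _ hp.pos,
      List.sum_cons, zero_add, mul_comm p b, pow_mul, gaussSum_pow_char]
    exact h
  · have hG1 := valuation_gaussSum_teichmullerChar_inv hτ hvp hζ (F := F) (by omega)
    obtain ⟨b, rfl⟩ : ∃ b, a = b + 1 := ⟨a - 1, by omega⟩
    have hmod : (b + 1) % p = b % p + 1 := by
      have h0 : (b + 1) % p ≠ 0 := fun h => hpa (Nat.dvd_of_mod_eq_zero h)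
      have h1 := Nat.mod_lt b hp.pos
      rw [Nat.add_mod, Nat.mod_eq_of_lt hp.one_lt] at h0 ⊢
      refine Nat.mod_eq_of_lt (lt_of_le_of_ne h1 fun h => h0 ?_)
      rw [show b % p + 1 = p from h, Nat.mod_self]
    have hdiv : (b + 1) / p = b / p := by
      rw [Nat.succ_div, if_neg hpa, add_zero]
    rcases Nat.eq_zero_or_pos b with rfl | hb
    · rw [zero_add, pow_one, hG1, Nat.digits_of_lt p 1 one_ne_zero hp.one_lt]
      simp
    · have h := ih b (by omega) hb (by omega)
      have hs : (p.digits (b + 1)).sum = (p.digits b).sum + 1 := by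
        rw [Nat.digits_def' hp.one_lt ha, Nat.digits_def' hp.one_lt hb, hmod, hdiv]
        simp only [List.sum_cons]; ring
      rw [hs, pow_succ, pow_succ]
      refine (mul_le_mul' h hG1.ge).trans (valuation_gaussSum_mul_le ?_ _)
      rw [← pow_succ, Ne, teichmullerChar_inv_pow_eq_one_iff hτ]
      exact fun hd => (Nat.le_of_dvd ha hd).not_gt ha'

theorem sum_digits_mul_geom_sum {p d : ℕ} (hp : 1 < p) (hd : d < p) (k : ℕ) :
    (p.digits (d * ∑ i ∈ Finset.range k, p ^ i)).sum = k * d := by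
  rcases Nat.eq_zero_or_pos d with rfl | hd0
  · simp
  induction k with
  | zero => simp
  | succ k ih =>
    have : d * ∑ i ∈ Finset.range (k + 1), p ^ i =
        d + p * (d * ∑ i ∈ Finset.range k, p ^ i) := by
      rw [geom_sum_succ]; ring
    rw [this, Nat.digits_add p hp d _ hd (Or.inl hd0.ne'), List.sum_cons, ih]
    ring

/-- Stickelberger's theorem for characters factoring through the norm to the prime field. -/
theorem valuation_gaussSum_geom_sum [Algebra (ZMod p) F] (hτ : ∀ w, v (τ w) ≤ 1)
    (hvp : v (p : L) < 1) {ζ : L} (hζ : IsPrimitiveRoot ζ p) {k d : ℕ}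
    (hk : Fintype.card F = p ^ k) (hd : 0 < d) (hd' : d < p - 1) :
    v (gaussSum ((teichmullerChar τ)⁻¹ ^ (d * ∑ i ∈ Finset.range k, p ^ i))
      (traceChar hζ.pow_eq_one)) = v (1 - ζ) ^ (k * d) := by
  have hp : p.Prime := Fact.out
  obtain ⟨e, he⟩ : ∃ e, d + e = p - 1 := ⟨p - 1 - d, by omega⟩
  set S := ∑ i ∈ Finset.range k, p ^ i with hS
  have hSp : (d + e) * S = Fintype.card F - 1 := by
    rw [he, hS, hk, Nat.geomSum_eq hp.two_le,
      Nat.mul_div_cancel' (Nat.sub_one_dvd_pow_sub_one p k)]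
  have hF := Fintype.one_lt_card (α := F)
  have hS0 : 0 < S := Nat.pos_of_ne_zero fun h => by rw [h, mul_zero] at hSp; omega
  have hdS : 0 < d * S := Nat.mul_pos hd hS0
  have heS : 0 < e * S := Nat.mul_pos (by omega) hS0
  rw [add_mul] at hSp
  have h1 := le_valuation_gaussSum hτ hvp hζ (F := F) hdS (by omega)
  have h2 := le_valuation_gaussSum hτ hvp hζ (F := F) heS (by omega)
  rw [hS, sum_digits_mul_geom_sum hp.one_lt (by omega), ← hS] at h1 h2
  have hinv : ((teichmullerChar τ)⁻¹ ^ (d * S))⁻¹ = (teichmullerChar τ)⁻¹ ^ (e * S) := by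
    rw [inv_eq_iff_mul_eq_one, ← pow_add, teichmullerChar_inv_pow_eq_one_iff hτ, hSp]
  have hne : (teichmullerChar τ)⁻¹ ^ (d * S) ≠ 1 := by
    rw [Ne, teichmullerChar_inv_pow_eq_one_iff hτ]
    exact fun h => (Nat.le_of_dvd hdS h).not_gt (by omega)
  have h3 := valuation_gaussSum_mul_inv (v := v) hne (traceChar_isPrimitive hζ)
  rw [hinv, hk, Nat.cast_pow, map_pow, ← valuation_one_sub_pow_pred v hp hζ, ← pow_mul, ← he,
    add_mul, mul_comm d k, mul_comm e k, pow_add] at h3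
  have hpos : v (1 - ζ) ≠ 0 :=
    v.ne_zero_iff.2 (sub_ne_zero.2 (hζ.ne_one hp.one_lt).symm)
  refine le_antisymm ?_ h1
  refine le_of_mul_le_mul_right ?_ (zero_lt_iff.2 (pow_ne_zero (k * e) hpos))
  rw [← h3]
  exact mul_le_mul_right h2 _

end GaussSum

section CharacterSums

variable {F L : Type*} [Field F] [Field L]

theorem sum_units_mulChar_pow {K : Type*} [Field K] [Fintype K] [Algebra K F] {ω : MulChar F L}
    (hω : Function.Injective ω) (a : ℕ) :
    ∑ y : Kˣ, ω (algebraMap K F y) ^ a =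
      if Fintype.card K - 1 ∣ a then ((Fintype.card K - 1 : ℕ) : L) else 0 := by
  let f : Kˣ →* L :=
    { toFun y := ω (algebraMap K F y) ^ a
      map_one' := by simp
      map_mul' := by simp [mul_pow] }
  have hf : f = 1 ↔ Fintype.card K - 1 ∣ a := by
    rw [← FiniteField.forall_pow_eq_one_iff, DFunLike.ext_iff]
    refine forall_congr' fun y => ?_
    change ω (algebraMap K F y) ^ a = 1 ↔ _
    rw [← map_pow, ← map_pow, ← ω.map_one, hω.eq_iff, ← (algebraMap K F).map_one,
      (algebraMap K F).injective.eq_iff, Units.ext_iff]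
    simp
  have h := sum_hom_units f
  simp only [hf, Fintype.card_units] at h
  exact_mod_cast h

variable [Fintype F]

theorem gaussSum_eq_sum_units (χ : MulChar F L) (ψ : AddChar F L) :
    gaussSum χ ψ = ∑ u : Fˣ, χ u * ψ u := by
  rw [gaussSum, Fintype.sum_eq_zero_add_sum_units, χ.map_zero, zero_mul, zero_add]

/-- The expansion of an additive character in multiplicative characters. -/
theorem card_sub_one_mul_addChar {ω : MulChar F L} (hω : Function.Injective ω) (ψ : AddChar F L)
    (x : Fˣ) :
    ((Fintype.card F - 1 : ℕ) : L) * ψ x =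
      ∑ a ∈ Finset.range (Fintype.card F - 1), ω x ^ a * gaussSum (ω⁻¹ ^ a) ψ := by
  have hsum (z : Fˣ) : ∑ a ∈ Finset.range (Fintype.card F - 1), ω x ^ a * (ω⁻¹ ^ a) z =
      if z = x then ((Fintype.card F - 1 : ℕ) : L) else 0 := by
    have h (a : ℕ) : ω x ^ a * (ω⁻¹ ^ a) z = ω ((x * z⁻¹ : Fˣ) : F) ^ a := by
      rw [MulChar.pow_apply_coe, MulChar.inv_apply', ← mul_pow, ← map_mul, Units.val_mul,
        Units.val_inv_eq_inv_val]
    simp_rw [h]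
    split_ifs with hz
    · simp [hz]
    · have hne : ω ((x * z⁻¹ : Fˣ) : F) ≠ 1 := by
        rw [← ω.map_one, hω.ne_iff, ← Units.val_one, Ne, ← Units.ext_iff, mul_inv_eq_one]
        exact fun h => hz h.symm
      rw [geom_sum_eq hne, ← map_pow, ← Units.val_pow_eq_pow_val, ← Fintype.card_units,
        pow_card_eq_one, Units.val_one, map_one, sub_self, zero_div]
  simp_rw [gaussSum_eq_sum_units, Finset.mul_sum, ← mul_assoc]
  rw [Finset.sum_comm]
  simp_rw [← Finset.sum_mul, hsum, ite_mul, zero_mul]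
  simp

theorem sum_fin_pow_eq {u : L} {n : ℕ} (hu : u ^ n = 1) :
    ∑ j : Fin n, u ^ (j : ℕ) = if u = 1 then (n : L) else 0 := by
  rw [Fin.sum_univ_eq_sum_range (fun j => u ^ j) n]
  split_ifs with h
  · simp [h]
  · rw [geom_sum_eq h, hu, sub_self, zero_div]

theorem sum_range_mul_ite_dvd {M : Type*} [AddCommMonoid M] {A : ℕ} (hA : 0 < A) (B : ℕ)
    (f : ℕ → M) :
    ∑ a ∈ Finset.range (B * A), (if A ∣ a then f a else 0) = ∑ j ∈ Finset.range B, f (j * A) := by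
  rw [← Finset.sum_filter]
  symm
  refine Finset.sum_bij (fun j _ => j * A) (fun j hj => ?_) (fun i _ j _ h => ?_)
    (fun a ha => ?_) fun _ _ => rfl
  · simpa [hA] using hj
  · exact Nat.eq_of_mul_eq_mul_right hA h
  · obtain ⟨h1, j, rfl⟩ := by simpa using ha
    refine ⟨j, ?_, mul_comm _ _⟩
    rw [mul_comm] at h1
    simpa using lt_of_mul_lt_mul_right h1 hA.le

end CharacterSums

theorem dvd_and_dvd_iff_div_gcd_dvd {R Q N n a : ℕ} (hR : 0 < R) (hN : N * n = R) (hQ : Q ∣ R) :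
    Q ∣ a ∧ n ∣ a ↔ R / N.gcd (R / Q) ∣ a := by
  obtain ⟨M, rfl⟩ := hQ
  have hQ0 : 0 < Q := Nat.pos_of_mul_pos_right hR
  rw [Nat.mul_div_cancel_left _ hQ0]
  have hN0 : 0 < N := Nat.pos_of_ne_zero fun h => by rw [h, zero_mul] at hN; omega
  have hg : 0 < N.gcd M := Nat.gcd_pos_of_pos_left _ hN0
  obtain ⟨A, hA⟩ : N.gcd M ∣ Q * M := (Nat.gcd_dvd_right _ _).mul_left _
  rw [hA, Nat.mul_div_cancel_left _ hg]
  constructor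
  · rintro ⟨h1, h2⟩
    have h3 : N.gcd M * A ∣ N * a := by
      rw [← hA, ← hN]; exact mul_dvd_mul_left _ h2
    have h4 : N.gcd M * A ∣ M * a := by
      rw [← hA, mul_comm Q]; exact mul_dvd_mul_left _ h1
    have h5 := Nat.dvd_gcd h3 h4
    rw [Nat.gcd_mul_right] at h5
    exact Nat.dvd_of_mul_dvd_mul_left hg h5
  · intro h
    refine ⟨dvd_trans ?_ h, dvd_trans ?_ h⟩
    · obtain ⟨c, hc⟩ := Nat.gcd_dvd_right N M
      refine ⟨c, Nat.eq_of_mul_eq_mul_left hg ?_⟩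
      rw [← hA]; conv_lhs => rw [hc]
      ring
    · obtain ⟨c, hc⟩ := Nat.gcd_dvd_left N M
      refine ⟨c, Nat.eq_of_mul_eq_mul_left hg ?_⟩
      rw [← hA, ← hN]; conv_lhs => rw [hc]
      ring

section Weight

variable {K F : Type} [Field K] [Field F] [Algebra K F]
  {L : Type*} [Field L]

theorem sum_ite_trace_eq_sub_codewordWeight (θ : F) (n : ℕ) (β : F) (c : L) :
    ∑ j : Fin n, (if Algebra.trace K F (β * θ ^ (j : ℕ)) = 0 then c else 0) =
      c * (n - codewordWeight K F θ n β) := by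
  have h := Finset.card_filter_add_card_filter_not (s := (Finset.univ : Finset (Fin n)))
    (fun j : Fin n => Algebra.trace K F (β * θ ^ (j : ℕ)) = 0)
  rw [Finset.card_univ, Fintype.card_fin] at h
  rw [← Finset.sum_filter, Finset.sum_const, nsmul_eq_mul]
  have h' := congrArg (Nat.cast : ℕ → L) h
  push_cast at h'
  rw [← h', codewordWeight]
  ring

theorem sum_units_addChar_trace [Fintype K] {ψ : AddChar K L} (hψ : ψ.IsPrimitive) (x : F) :
    ∑ y : Kˣ, ψ (Algebra.trace K F (algebraMap K F y * x)) =
      (if Algebra.trace K F x = 0 then (Fintype.card K : L) else 0) - 1 := by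
  have h := AddChar.sum_mulShift (Algebra.trace K F x) hψ
  rw [Fintype.sum_eq_zero_add_sum_units, zero_mul, AddChar.map_zero_eq_one] at h
  simp_rw [← Algebra.smul_def, map_smul, smul_eq_mul]
  rw [eq_sub_iff_add_eq', h]
  split_ifs <;> simp

/-- The weight of a codeword in terms of Gauss sums. -/
theorem card_mul_codewordWeight [Fintype K] [Fintype F] {ω : MulChar F L} (hω : Function.Injective ω) {ψ : AddChar K L}
    (hψ : ψ.IsPrimitive) (α : Fˣ) (hα : orderOf α = Fintype.card F - 1) {N n M : ℕ}
    (hn : N * n = Fintype.card F - 1) (hK : Fintype.card K - 1 ∣ Fintype.card F - 1)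
    (hM : N.gcd ((Fintype.card F - 1) / (Fintype.card K - 1)) = M + 1) (β : Fˣ) :
    (Fintype.card K : L) * codewordWeight K F ((α ^ N : Fˣ) : F) n β *
        ((Fintype.card F - 1 : ℕ) : L) =
      ((Fintype.card K - 1 : ℕ) : L) * n * (Fintype.card F - ∑ j ∈ Finset.range M,
        ω β ^ ((j + 1) * ((Fintype.card F - 1) / (M + 1))) *
          gaussSum (ω⁻¹ ^ ((j + 1) * ((Fintype.card F - 1) / (M + 1))))
            (ψ.compAddMonoidHom (Algebra.trace K F).toAddMonoidHom)) := by
  set ψF := ψ.compAddMonoidHom (Algebra.trace K F).toAddMonoidHom with hψF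
  set θ : F := ((α ^ N : Fˣ) : F) with hθ
  have hF := Fintype.one_lt_card (α := F)
  have hKc := Fintype.one_lt_card (α := K)
  set R := Fintype.card F - 1 with hR
  have hR0 : 0 < R := by omega
  set A := R / (M + 1) with hAdef
  have hMR : M + 1 ∣ R := hM ▸ (Nat.gcd_dvd_left _ _).trans ⟨n, hn.symm⟩
  have hA : (M + 1) * A = R := Nat.mul_div_cancel' hMR
  have hA0 : 0 < A := Nat.pos_of_ne_zero fun h => by rw [h] at hA; omega
  have hθ1 (a : ℕ) : ω θ ^ a = 1 ↔ n ∣ a := by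
    have hN0 : 0 < N := Nat.pos_of_ne_zero fun h => by rw [h] at hn; omega
    rw [← map_pow, ← ω.map_one, hω.eq_iff, hθ, ← Units.val_pow_eq_pow_val, ← Units.val_one,
      ← Units.ext_iff, ← pow_mul, ← orderOf_dvd_iff_pow_eq_one, hα, ← hn,
      Nat.mul_dvd_mul_iff_left hN0]
  have hsum1 : ∑ j : Fin n, ∑ y : Kˣ, ψF (algebraMap K F y * (β * θ ^ (j : ℕ))) =
      Fintype.card K * (n - codewordWeight K F θ n β) - n := by
    have h (j : Fin n) : ∑ y : Kˣ, ψF (algebraMap K F y * (β * θ ^ (j : ℕ))) = _ :=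
      sum_units_addChar_trace hψ _
    rw [Finset.sum_congr rfl fun j _ => h j, Finset.sum_sub_distrib,
      sum_ite_trace_eq_sub_codewordWeight]
    simp
  have hsum2 : (R : L) * ∑ j : Fin n, ∑ y : Kˣ, ψF (algebraMap K F y * (β * θ ^ (j : ℕ))) =
      ∑ a ∈ Finset.range R, ω β ^ a * gaussSum (ω⁻¹ ^ a) ψF *
        ((∑ y : Kˣ, ω (algebraMap K F y) ^ a) * ∑ j : Fin n, (ω θ ^ a) ^ (j : ℕ)) := by
    have h (j : Fin n) (y : Kˣ) : (R : L) * ψF (algebraMap K F y * (β * θ ^ (j : ℕ))) =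
        ∑ a ∈ Finset.range R, ω β ^ a * gaussSum (ω⁻¹ ^ a) ψF *
          (ω (algebraMap K F y) ^ a * (ω θ ^ a) ^ (j : ℕ)) := by
      have h1 := card_sub_one_mul_addChar hω ψF
        (Units.map (algebraMap K F).toMonoidHom y * (β * (α ^ N) ^ (j : ℕ)))
      simp only [Units.val_mul, Units.coe_map, Units.val_pow_eq_pow_val] at h1
      rw [hθ, Units.val_pow_eq_pow_val]
      refine h1.trans (Finset.sum_congr rfl fun a _ => ?_)
      simp only [map_mul, map_pow, mul_pow]
      simp only [RingHom.toMonoidHom_eq_coe, MonoidHom.coe_coe]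
      ring
    calc
      _ = ∑ j : Fin n, ∑ y : Kˣ, ∑ a ∈ Finset.range R, ω β ^ a * gaussSum (ω⁻¹ ^ a) ψF *
          (ω (algebraMap K F y) ^ a * (ω θ ^ a) ^ (j : ℕ)) := by
        rw [Finset.mul_sum]
        refine Finset.sum_congr rfl fun j _ => ?_
        rw [Finset.mul_sum]
        exact Finset.sum_congr rfl fun y _ => h j y
      _ = ∑ a ∈ Finset.range R, ∑ y : Kˣ, ∑ j : Fin n, ω β ^ a * gaussSum (ω⁻¹ ^ a) ψF *
          (ω (algebraMap K F y) ^ a * (ω θ ^ a) ^ (j : ℕ)) := by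
        rw [Finset.sum_congr rfl fun j _ => Finset.sum_comm, Finset.sum_comm]
        exact Finset.sum_congr rfl fun a _ => Finset.sum_comm
      _ = _ := by simp_rw [Finset.sum_mul_sum, Finset.mul_sum]
  have hbr (a : ℕ) : (∑ y : Kˣ, ω (algebraMap K F y) ^ a) * ∑ j : Fin n, (ω θ ^ a) ^ (j : ℕ) =
      if A ∣ a then ((Fintype.card K - 1 : ℕ) : L) * n else 0 := by
    have hu : (ω θ ^ a) ^ n = 1 := by rw [← pow_mul, hθ1]; exact dvd_mul_left _ _
    rw [sum_units_mulChar_pow hω, sum_fin_pow_eq hu, hθ1]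
    have := dvd_and_dvd_iff_div_gcd_dvd (a := a) hR0 hn hK
    rw [hM, ← hAdef] at this
    by_cases h1 : Fintype.card K - 1 ∣ a <;> by_cases h2 : n ∣ a <;> simp [h1, h2, ← this]
  have hψ1 : ψF ≠ 1 := by
    intro h
    refine hψ (one_ne_zero) (?_ : ψ.mulShift 1 = 1)
    ext x
    obtain ⟨z, rfl⟩ := Algebra.trace_surjective K F x
    rw [AddChar.mulShift_apply, one_mul]
    exact DFunLike.congr_fun h z
  rw [hsum1] at hsum2
  simp_rw [hbr, mul_ite, mul_zero] at hsum2
  rw [← hA, sum_range_mul_ite_dvd hA0, hA, Finset.sum_range_succ', ← Finset.sum_mul] at hsum2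
  rw [zero_mul, pow_zero, pow_zero, gaussSum_one_left hψ1] at hsum2
  have hc1 : ((R : ℕ) : L) = Fintype.card F - 1 := by
    rw [hR, Nat.cast_sub hF.le, Nat.cast_one]
  have hc2 : ((Fintype.card K - 1 : ℕ) : L) = Fintype.card K - 1 := by
    rw [Nat.cast_sub hKc.le, Nat.cast_one]
  rw [hc1] at hsum2 ⊢
  rw [hc2] at hsum2 ⊢
  linear_combination -hsum2

end Weight

theorem gcd_dvd_of_modEq_one {q m N : ℕ} (hq : 2 ≤ q)
    (h : q ≡ 1 [MOD N.gcd ((q ^ m - 1) / (q - 1))]) : N.gcd ((q ^ m - 1) / (q - 1)) ∣ m := by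
  have h1 := Nat.gcd_dvd_right N ((q ^ m - 1) / (q - 1))
  set g := N.gcd ((q ^ m - 1) / (q - 1))
  rw [← Nat.geomSum_eq hq, ← ZMod.natCast_eq_zero_iff] at h1
  rw [← ZMod.natCast_eq_natCast_iff] at h
  push_cast at h h1
  rw [← ZMod.natCast_eq_zero_iff, ← h1]
  simp [h]

/-- if `p ≡ 1 (mod N₂)` then for every `β ∈ GF(r)*`,
`q^{m/N₂-1}` divides `wt(c(β))` but `q^{m/N₂}` does not. -/
theorem stmt15 (p s m N q r n N₂ : ℕ) (hp : p.Prime) (hs : 0 < s) (hm : 0 < m)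
    (hq : q = p ^ s) (hr : r = q ^ m) (hN : N ∣ r - 1) (hn : n = (r - 1) / N)
    (hN₂ : N₂ = Nat.gcd N ((r - 1) / (q - 1))) (hpN₂ : p ≡ 1 [MOD N₂])
    (K F : Type) [Field K] [Fintype K] [Field F] [Fintype F] [Algebra K F]
    (hcardK : Fintype.card K = q) (hcardF : Fintype.card F = r)
    (α : Fˣ) (hα : ∀ x : Fˣ, x ∈ Subgroup.zpowers α)
    (hθ : ∀ x : F, x ∈ Algebra.adjoin K {((α ^ N : Fˣ) : F)}) :
    ∀ β : Fˣ,
      q ^ (m / N₂ - 1) ∣ codewordWeight K F ((α ^ N : Fˣ) : F) n (β : F) ∧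
      ¬ q ^ (m / N₂) ∣ codewordWeight K F ((α ^ N : Fˣ) : F) n (β : F) := by
  intro β
  have hpf : Fact p.Prime := ⟨hp⟩
  have hq2 : 2 ≤ q := hcardK ▸ Fintype.one_lt_card (α := K)
  have hr2 : 2 ≤ r := hcardF ▸ Fintype.one_lt_card (α := F)
  have hN₂m : N₂ ∣ m := by
    have h : q ≡ 1 [MOD N₂] := by simpa [hq] using hpN₂.pow s
    rw [hN₂, hr] at h ⊢
    exact gcd_dvd_of_modEq_one hq2 h
  have hN₂p : N₂ ∣ p - 1 := (Nat.modEq_iff_dvd' hp.one_lt.le).1 hpN₂.symm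
  obtain ⟨t, rfl⟩ := hN₂m
  have hN₂0 : 0 < N₂ := Nat.pos_of_mul_pos_right hm
  have ht : 0 < t := Nat.pos_of_mul_pos_left hm
  rw [Nat.mul_div_cancel_left _ hN₂0]
  obtain ⟨M, rfl⟩ : ∃ M, N₂ = M + 1 := ⟨N₂ - 1, by omega⟩
  have hNn : N * n = r - 1 := by rw [hn, Nat.mul_div_cancel' hN]
  have hqr : q - 1 ∣ r - 1 := hr ▸ Nat.sub_one_dvd_pow_sub_one q _
  have hrp : r = p ^ (s * ((M + 1) * t)) := by rw [hr, hq, ← pow_mul]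
  have hpq : p ∣ q := hq ▸ dvd_pow_self p hs.ne'
  have hpr : p ∣ r := hrp ▸ dvd_pow_self p (Nat.mul_pos hs hm).ne'
  have hndvd {x : ℕ} (hx : 2 ≤ x) (hpx : p ∣ x) : ¬ p ∣ x - 1 := fun h => by
    have := (Nat.dvd_sub hpx h)
    rw [Nat.sub_sub_self (by omega), Nat.dvd_one] at this
    exact hp.ne_one this
  have hpn : ¬ p ∣ n := fun h => hndvd hr2 hpr (hNn ▸ h.mul_left N)
  -- the coefficient field
  have : CharP K p := charP_of_card_eq_prime_pow (hcardK.trans hq)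
  have : CharP F p := charP_of_injective_algebraMap (algebraMap K F).injective p
  let : Algebra (ZMod p) K := ZMod.algebra K p
  let : Algebra (ZMod p) F := ZMod.algebra F p
  have : IsScalarTower (ZMod p) K F := IsScalarTower.of_algebraMap_eq' (Subsingleton.elim _ _)
  obtain ⟨B, τ, hτ, hτ1, hvp⟩ := exists_valuation_algebraicClosure_wittVector p F
  set L := AlgebraicClosure (FractionRing (WittVector p F))
  set v := B.valuation
  have hp0 : (p : L) ≠ 0 := by
    rw [← map_natCast τ, Ne, map_eq_zero_iff τ hτ]
    exact WittVector.p_nonzero p F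
  have : NeZero (p : L) := ⟨hp0⟩
  obtain ⟨ζ, hζ⟩ := HasEnoughRootsOfUnity.exists_primitiveRoot L p
  have hω : Function.Injective (teichmullerChar τ) := teichmullerChar_injective hτ1
  have hψ : (traceChar hζ.pow_eq_one : AddChar K L).compAddMonoidHom
      (Algebra.trace K F).toAddMonoidHom = traceChar hζ.pow_eq_one := by
    ext x
    change traceChar hζ.pow_eq_one (Algebra.trace K F x) = _
    rw [traceChar_apply, traceChar_apply, Algebra.trace_trace]
  have hαo : orderOf α = Fintype.card F - 1 := by
    rw [orderOf_eq_card_of_forall_mem_zpowers hα, Nat.card_eq_fintype_card, Fintype.card_units]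
  have key := card_mul_codewordWeight hω (traceChar_isPrimitive hζ (F := K)) α hαo
    (hNn.trans (by rw [hcardF])) (by rw [hcardK, hcardF]; exact hqr)
    (M := M) (by rw [hcardK, hcardF]; exact hN₂.symm) β
  rw [hψ, hcardK, hcardF] at key
  set W := codewordWeight K F ((α ^ N : Fˣ) : F) n (β : F)
  -- the valuations of the Gauss sums
  obtain ⟨d, hd⟩ := hN₂p
  have hd0 : 0 < d := Nat.pos_of_ne_zero fun h => by
    have := hp.one_lt; rw [h, mul_zero] at hd; omega
  set k := s * ((M + 1) * t) with hk
  have hA : (r - 1) / (M + 1) = d * ∑ i ∈ Finset.range k, p ^ i := by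
    refine Nat.div_eq_of_eq_mul_right hN₂0 ?_
    rw [← mul_assoc, ← hd, Nat.geomSum_eq hp.two_le, hrp,
      Nat.mul_div_cancel' (Nat.sub_one_dvd_pow_sub_one p k)]
  let c (j : ℕ) : L := if j = M then (r : L) else
    -(teichmullerChar τ β ^ ((j + 1) * ((r - 1) / (M + 1))) *
      gaussSum ((teichmullerChar τ)⁻¹ ^ ((j + 1) * ((r - 1) / (M + 1))))
        (traceChar hζ.pow_eq_one))
  have hβ : v (teichmullerChar τ β) = 1 := by
    refine valuation_eq_one_of_pow_eq_one v (Fintype.card_ne_zero (α := Fˣ)) ?_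
    rw [← map_pow, ← Units.val_pow_eq_pow_val, pow_card_eq_one, Units.val_one, map_one]
  have hc (j : ℕ) (hj : j < M + 1) : v (c j) = v (p : L) ^ (s * t * (j + 1)) := by
    simp only [c]
    split_ifs with h
    · rw [h, hrp, Nat.cast_pow, map_pow, hk]
      congr 1; ring
    · have hlt : (j + 1) * d < p - 1 := by
        rw [hd]; exact Nat.mul_lt_mul_of_pos_right (by omega) hd0
      rw [Valuation.map_neg, map_mul, map_pow, hβ, one_pow, one_mul, hA, ← mul_assoc,
        valuation_gaussSum_geom_sum hτ1 hvp hζ (hcardF.trans hrp) (Nat.mul_pos (by omega : 0 < j + 1) hd0) hlt,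
        ← valuation_one_sub_pow_pred v hp hζ, ← pow_mul, hd, hk]
      congr 1; ring
  have hsum : v ((r : L) - ∑ j ∈ Finset.range M,
      teichmullerChar τ β ^ ((j + 1) * ((r - 1) / (M + 1))) *
      gaussSum ((teichmullerChar τ)⁻¹ ^ ((j + 1) * ((r - 1) / (M + 1))))
        (traceChar hζ.pow_eq_one)) = v (p : L) ^ (s * t) := by
    have h1 : ∑ j ∈ Finset.range (M + 1), c j = (r : L) - ∑ j ∈ Finset.range M,
        teichmullerChar τ β ^ ((j + 1) * ((r - 1) / (M + 1))) *
        gaussSum ((teichmullerChar τ)⁻¹ ^ ((j + 1) * ((r - 1) / (M + 1))))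
          (traceChar hζ.pow_eq_one) := by
      rw [Finset.sum_range_succ, add_comm, sub_eq_add_neg, ← Finset.sum_neg_distrib]
      congr 1
      · simp [c]
      · exact Finset.sum_congr rfl fun j hj => if_neg (Finset.mem_range.1 hj).ne
    have h0 := hc 0 hN₂0
    rw [zero_add, mul_one] at h0
    rw [← h1, ← h0]
    refine v.map_sum_eq_of_lt (Finset.mem_range.2 hN₂0) fun j hj => ?_
    simp only [Finset.mem_sdiff, Finset.mem_range, Finset.mem_singleton] at hj
    rw [h0, hc j hj.1]
    refine pow_lt_pow_right_of_lt_one₀ (zero_lt_iff.2 (v.ne_zero_iff.2 hp0)) hvp ?_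
    have : 0 < s * t := Nat.mul_pos hs ht
    have : 0 < j := Nat.pos_of_ne_zero hj.2
    nlinarith
  have hval := congrArg v key
  rw [map_mul, map_mul, map_mul, map_mul, hsum,
    valuation_natCast_eq_one v hp hvp (hndvd hr2 hpr),
    valuation_natCast_eq_one v hp hvp (hndvd hq2 hpq), valuation_natCast_eq_one v hp hvp hpn,
    mul_one, one_mul, one_mul, hq, Nat.cast_pow, map_pow] at hval
  have hvp0 : v (p : L) ≠ 0 := v.ne_zero_iff.2 hp0
  have hW0 : W ≠ 0 := by
    intro h
    rw [h, Nat.cast_zero, map_zero, mul_zero] at hval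
    exact pow_ne_zero _ hvp0 hval.symm
  obtain ⟨e, u, hu, hWu⟩ := Nat.exists_eq_pow_mul_and_not_dvd hW0 p hp.ne_one
  rw [hWu, Nat.cast_mul, Nat.cast_pow, map_mul, map_pow, valuation_natCast_eq_one v hp hvp hu,
    mul_one, ← pow_add] at hval
  have he : s + e = s * t :=
    (pow_right_strictAnti₀ (zero_lt_iff.2 hvp0) hvp).injective hval
  obtain ⟨t, rfl⟩ : ∃ t', t = t' + 1 := ⟨t - 1, by omega⟩
  have he' : e = s * t := by rw [mul_add] at he; omega
  rw [hWu, hq, ← pow_mul, ← pow_mul, Nat.add_sub_cancel, he']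
  refine ⟨dvd_mul_right _ _, fun h => hu ?_⟩
  rw [mul_add, mul_one, pow_add] at h
  exact (dvd_pow_self p hs.ne').trans (Nat.dvd_of_mul_dvd_mul_left (pow_pos hp.pos _) h)
end

section
/- If N₂ = 2, then C(r,N) is a two-weight code: exactly (r-1)/2 nonzero codewords have weight (q-1)(r - √r)/(Nq) and (r-1)/2 have weight (q-1)(r + √r)/(Nq). -/
open scoped Classical

theorem sum_range_pow_add {M R : Type*} [Monoid M] [AddCommMonoid R] (g : M → R) {θ : M} {n : ℕ}
    (hθ : θ ^ n = 1) (i : ℕ) :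
    ∑ j ∈ Finset.range n, g (θ ^ (i + j)) = ∑ j ∈ Finset.range n, g (θ ^ j) := by
  induction i with
  | zero => simp
  | succ i ih =>
    rw [← ih]
    cases n with
    | zero => simp
    | succ n =>
      rw [Finset.sum_range_succ, Finset.sum_range_succ' (fun j => g (θ ^ (i + j)))]
      have h : θ ^ (i + 1 + n) = θ ^ (i + 0) := by
        rw [show i + 1 + n = i + (n + 1) by ring, pow_add, hθ]; simp
      rw [h]
      congr 1
      exact Finset.sum_congr rfl fun j _ => by rw [show i + 1 + j = i + (j + 1) by ring]

/-- Averaging a function over the powers of `θ` is the same as averaging it over the nonzero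
squares when every nonzero square is, up to a scalar in `K`, a power of `θ`. -/
theorem sum_pow_eq_sum_quadraticChar {K F : Type*} [Field K] [Field F] [Fintype F] [Algebra K F]
    (hF : ringChar F ≠ 2) {θ : F} {n : ℕ} (hθ : θ ^ n = 1) (hχ : quadraticChar F θ = 1)
    (hsq : ∀ x : F, quadraticChar F x = 1 → ∃ c : K, c ≠ 0 ∧ ∃ i : ℕ, x = algebraMap K F c * θ ^ i)
    (f : F → ℂ) (hf0 : f 0 = 0) (hf : ∀ c : K, c ≠ 0 → ∀ x, f (algebraMap K F c * x) = f x)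
    (β : F) :
    ((Fintype.card F : ℂ) - 1) * ∑ j ∈ Finset.range n, f (β * θ ^ j) =
      n * ∑ x : F, (1 + (quadraticChar F x : ℂ)) * f (β * x) := by
  have hθ0 : θ ≠ 0 := by
    rintro rfl
    simp at hχ
  have hone : ∀ x : F, (1 + (quadraticChar F x : ℂ)) * ∑ j ∈ Finset.range n, f (β * x * θ ^ j) =
      (1 + (quadraticChar F x : ℂ) - if x = 0 then 1 else 0) *
        ∑ j ∈ Finset.range n, f (β * θ ^ j) := by
    intro x
    by_cases hx : x = 0
    · simp [hx, hf0]
    rcases quadraticChar_dichotomy hx with h | h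
    · obtain ⟨c, hc, i, rfl⟩ := hsq x h
      simp only [hx, if_false, sub_zero]
      congr 1
      rw [← sum_range_pow_add (fun y => f (β * y)) hθ i]
      refine Finset.sum_congr rfl fun j _ => ?_
      rw [← hf c hc (β * θ ^ (i + j)), pow_add]
      congr 1
      ring
    · simp [h, hx]
  have hsum : ∑ x : F, (1 + (quadraticChar F x : ℂ) - if x = 0 then 1 else 0) =
      (Fintype.card F : ℂ) - 1 := by
    have h0 : ∑ x : F, (quadraticChar F x : ℂ) = 0 := by
      exact_mod_cast quadraticChar_sum_zero hF
    simp [Finset.sum_sub_distrib, Finset.sum_add_distrib, h0, -quadraticChar_apply]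
  rw [← hsum, Finset.sum_mul, ← Finset.sum_congr rfl fun x _ => hone x]
  simp_rw [Finset.mul_sum]
  rw [Finset.sum_comm]
  have hj : ∀ j ∈ Finset.range n,
      ∑ x : F, (1 + (quadraticChar F x : ℂ)) * f (β * x * θ ^ j) =
        ∑ x : F, (1 + (quadraticChar F x : ℂ)) * f (β * x) := by
    intro j _
    refine Fintype.sum_equiv (Equiv.mulRight₀ (θ ^ j) (pow_ne_zero j hθ0)) _ _ fun x => ?_
    simp [hχ, mul_assoc, -quadraticChar_apply]
  rw [Finset.sum_congr rfl hj]
  simp [Finset.mul_sum]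

/-- The quadratic Gauss sum evaluates the number of squares with nonzero trace. -/
theorem exists_sum_quadraticChar_trace {K F : Type} [Field K] [Fintype K] [Field F] [Fintype F]
    [Algebra K F] (hF : ringChar F ≠ 2) {t : ℕ} (ht : t ^ 2 = Fintype.card F)
    (hK : ∀ c : K, c ≠ 0 → quadraticChar F (algebraMap K F c) = 1) :
    ∃ ε : ℤ, (ε = 1 ∨ ε = -1) ∧ ∀ β : F, β ≠ 0 →
      Fintype.card K * ∑ x : F, (1 + (quadraticChar F x : ℂ)) *
        (if Algebra.trace K F (β * x) ≠ 0 then 1 else 0) =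
      ((Fintype.card K : ℂ) - 1) * (Fintype.card F - ε * quadraticChar F β * t) := by
  set χ : MulChar F ℂ := (quadraticChar F).ringHomComp (Int.castRingHom ℂ)
  have hχa : ∀ x, χ x = (quadraticChar F x : ℂ) := fun x => rfl
  set φ : AddChar K ℂ := AddChar.FiniteField.primitiveChar_to_Complex K
  have hφ : φ.IsPrimitive := AddChar.FiniteField.primitiveChar_to_Complex_isPrimitive K
  set ψ : AddChar F ℂ := φ.compAddMonoidHom (Algebra.trace K F).toAddMonoidHom
  have hψa : ∀ x, ψ x = φ (Algebra.trace K F x) := fun x => rfl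
  have hφ1 : φ ≠ 1 := by
    have := hφ one_ne_zero
    simpa [AddChar.mulShift_one] using this
  have hψ : ψ.IsPrimitive := by
    refine AddChar.IsPrimitive.of_ne_one ?_
    obtain ⟨b, hb⟩ := AddChar.ne_one_iff.1 hφ1
    obtain ⟨x, rfl⟩ := Algebra.trace_surjective K F b
    exact AddChar.ne_one_iff.2 ⟨x, hb⟩
  have hχ1 : χ ≠ 1 := by
    obtain ⟨a, ha⟩ := quadraticChar_exists_neg_one' hF
    intro h
    have := hχa a
    rw [h, ha] at this
    norm_num at this
  have hχ2 : χ.IsQuadratic := (quadraticChar_isQuadratic F).comp _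
  have hneg : χ (-1) = 1 := by
    have : IsSquare (-1 : F) := by
      rw [FiniteField.isSquare_neg_one_iff, ← ht]
      have := Nat.mod_lt t (by norm_num : 0 < 4)
      rw [Nat.pow_mod]
      interval_cases t % 4 <;> norm_num
    rw [hχa, (quadraticChar_one_iff_isSquare (by simp)).2 this]
    simp
  have hg : gaussSum χ ψ ^ 2 = (t : ℂ) ^ 2 := by
    rw [gaussSum_sq hχ1 hχ2 hψ, hneg, ← ht]; push_cast; ring
  have hgs : ∀ a : F, a ≠ 0 → ∑ x : F, (quadraticChar F x : ℂ) * ψ (a * x) =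
      (quadraticChar F a : ℂ) * gaussSum χ ψ := by
    intro a ha
    have h := gaussSum_mulShift_eq χ ψ (Units.mk0 a ha)
    rw [hχ2.inv] at h
    exact h
  have hind : ∀ y : F, (Fintype.card K : ℂ) * (if Algebra.trace K F y ≠ 0 then 1 else 0) =
      Fintype.card K - ∑ c : K, ψ (algebraMap K F c * y) := by
    intro y
    have h := AddChar.sum_mulShift (Algebra.trace K F y) hφ
    have h' : ∀ c : K, ψ (algebraMap K F c * y) = φ (c * Algebra.trace K F y) := by
      intro c
      rw [hψa, ← Algebra.smul_def, map_smul, smul_eq_mul]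
    rw [Finset.sum_congr rfl fun c _ => h' c, h]
    by_cases h0 : Algebra.trace K F y = 0 <;> simp [h0]
  have hχsum : ∑ x : F, (quadraticChar F x : ℂ) = 0 := by
    exact_mod_cast quadraticChar_sum_zero hF
  have main : ∀ β : F, β ≠ 0 →
      Fintype.card K * ∑ x : F, (1 + (quadraticChar F x : ℂ)) *
        (if Algebra.trace K F (β * x) ≠ 0 then 1 else 0) =
      ((Fintype.card K : ℂ) - 1) *
        (Fintype.card F - quadraticChar F β * gaussSum χ ψ) := by
    intro β hβ
    have hc : ∀ c : K, ∑ x : F, (1 + (quadraticChar F x : ℂ)) * ψ (algebraMap K F c * (β * x)) =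
        quadraticChar F β * gaussSum χ ψ +
          if c = 0 then (Fintype.card F : ℂ) - quadraticChar F β * gaussSum χ ψ else 0 := by
      intro c
      by_cases hc : c = 0
      · simp [hc, Finset.sum_add_distrib, hχsum, -quadraticChar_apply]
      · have hc' : algebraMap K F c ≠ 0 := by simpa using hc
        have hcβ : algebraMap K F c * β ≠ 0 := mul_ne_zero hc' hβ
        have h1 := hgs _ hcβ
        have h2 := AddChar.sum_mulShift (algebraMap K F c * β) hψ
        rw [if_neg hcβ] at h2
        rw [map_mul, hK c hc, one_mul] at h1
        simp only [add_mul, one_mul, Finset.sum_add_distrib, ← mul_assoc] at h1 ⊢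
        rw [h1, if_neg hc, add_zero]
        simp only [mul_comm _ (algebraMap K F c * β), Nat.cast_zero] at h2
        rw [h2, zero_add]
    calc _ = ∑ x : F, (1 + (quadraticChar F x : ℂ)) *
          (Fintype.card K - ∑ c : K, ψ (algebraMap K F c * (β * x))) := by
          rw [Finset.mul_sum]
          refine Finset.sum_congr rfl fun x _ => ?_
          rw [← hind]; ring
      _ = Fintype.card F * Fintype.card K -
          ∑ c : K, ∑ x : F, (1 + (quadraticChar F x : ℂ)) * ψ (algebraMap K F c * (β * x)) := by
          rw [Finset.sum_comm]
          simp_rw [mul_sub, Finset.sum_sub_distrib, ← Finset.sum_mul, Finset.mul_sum]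
          simp [Finset.sum_add_distrib, hχsum, -quadraticChar_apply]
      _ = _ := by
          rw [Finset.sum_congr rfl fun c _ => hc c, Finset.sum_add_distrib]
          simp
          ring
  rcases sq_eq_sq_iff_eq_or_eq_neg.1 hg with h | h
  · exact ⟨1, Or.inl rfl, fun β hβ => by rw [main β hβ, h]; push_cast; ring⟩
  · exact ⟨-1, Or.inr rfl, fun β hβ => by rw [main β hβ, h]; push_cast; ring⟩

theorem codewordWeight_eq_sum {K F : Type} [Field K] [Field F] [Algebra K F]
    (θ : F) (n : ℕ) (β : F) :
    (codewordWeight K F θ n β : ℂ) = ∑ j ∈ Finset.range n,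
      if Algebra.trace K F (β * θ ^ j) ≠ 0 then (1 : ℂ) else 0 := by
  rw [codewordWeight, Finset.card_filter]
  push_cast
  exact Fin.sum_univ_eq_sum_range
    (fun j => if Algebra.trace K F (β * θ ^ j) ≠ 0 then (1 : ℂ) else 0) n

theorem card_units_filter_quadraticChar {F : Type*} [Field F] [Fintype F] (hF : ringChar F ≠ 2)
    {δ : ℤ} (hδ : δ = 1 ∨ δ = -1) :
    (Finset.univ.filter fun β : Fˣ => quadraticChar F (β : F) = δ).card =
      (Fintype.card F - 1) / 2 := by
  obtain ⟨a, ha⟩ := quadraticChar_exists_neg_one' hF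
  have hpm : (Finset.univ.filter fun β : Fˣ => quadraticChar F (β : F) = 1).card =
      (Finset.univ.filter fun β : Fˣ => quadraticChar F (β : F) = -1).card := by
    refine Finset.card_equiv (Equiv.mulLeft a) fun β => ?_
    simp [ha, -quadraticChar_apply]
  have htot := Finset.card_filter_add_card_filter_not (s := (Finset.univ : Finset Fˣ))
    (fun β : Fˣ => quadraticChar F (β : F) = 1)
  rw [Finset.filter_congr fun (β : Fˣ) _ =>
    (quadraticChar_eq_neg_one_iff_not_one β.ne_zero).symm, Finset.card_univ,
    Fintype.card_units] at htot
  rcases hδ with rfl | rfl <;> omega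

/-- The subgroup of squares of a cyclic group `Fˣ` is generated by `Kˣ` and the `N`-th powers when
`N` and the index of `Kˣ` have greatest common divisor `2`. -/
theorem exists_eq_algebraMap_mul_pow {K F : Type*} [Field K] [Finite K] [Field F] [Finite F]
    [Algebra K F] {N : ℕ} (hN : Nat.gcd N ((Nat.card F - 1) / (Nat.card K - 1)) = 2)
    {α : Fˣ} (hα : ∀ x : Fˣ, x ∈ Subgroup.zpowers α) {x : F} (hx0 : x ≠ 0) (hx : IsSquare x) :
    ∃ c : K, c ≠ 0 ∧ ∃ i : ℕ, x = algebraMap K F c * ((α ^ N : Fˣ) : F) ^ i := by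
  obtain ⟨y, rfl⟩ := hx
  have hy0 : y ≠ 0 := by
    rintro rfl
    simp at hx0
  obtain ⟨k, hk⟩ := hα (Units.mk0 y hy0)
  set M := (Nat.card F - 1) / (Nat.card K - 1)
  have hbez := Nat.gcd_eq_gcd_ab N M
  rw [hN] at hbez
  have hnorm : algebraMap K F (Algebra.norm K (α : F)) = (α : F) ^ M :=
    FiniteField.algebraMap_norm_eq_pow
  have hpow : (α ^ N) ^ (k * Nat.gcdA N M) ∈ Submonoid.powers (α ^ N) :=
    mem_powers_iff_mem_zpowers.2 ⟨_, rfl⟩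
  obtain ⟨i, hi⟩ := hpow
  refine ⟨Algebra.norm K (α : F) ^ (k * Nat.gcdB N M), zpow_ne_zero _ ?_, i, ?_⟩
  · intro h
    rw [h, map_zero] at hnorm
    exact pow_ne_zero M α.ne_zero hnorm.symm
  · have h2 : Units.mk0 y hy0 * Units.mk0 y hy0 = (α ^ M) ^ (k * Nat.gcdB N M) * (α ^ N) ^ i := by
      dsimp only at hi hk
      rw [hi, ← hk, ← zpow_natCast α M, ← zpow_natCast α N, ← zpow_mul, ← zpow_mul, ← zpow_add,
        ← zpow_add]
      congr 1
      push_cast at hbez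
      linear_combination k * hbez
    have h3 := congrArg Units.val h2
    simpa [hnorm] using h3

theorem quadraticChar_algebraMap_eq_one {K F : Type*} [Field K] [Finite K] [Field F] [Fintype F]
    [Algebra K F] (h : 2 ∣ (Nat.card F - 1) / (Nat.card K - 1)) {c : K} (hc : c ≠ 0) :
    quadraticChar F (algebraMap K F c) = 1 := by
  rw [quadraticChar_one_iff_isSquare (by simpa using hc)]
  obtain ⟨y, rfl⟩ := FiniteField.norm_surjective K F c
  rw [FiniteField.algebraMap_norm_eq_pow]
  exact (even_iff_two_dvd.2 h).isSquare_pow y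

/-- if `N₂ = 2` then `C(r,N)` is a two-weight code: exactly
`(r-1)/2` nonzero codewords have weight `(q-1)(r-√r)/(Nq)` and `(r-1)/2` have
weight `(q-1)(r+√r)/(Nq)`. -/
theorem stmt17 (p s m N q r n t : ℕ) (hp : p.Prime) (hs : 0 < s) (hm : 0 < m)
    (hq : q = p ^ s) (hr : r = q ^ m) (hN : N ∣ r - 1) (hn : n = (r - 1) / N)
    (hN₂ : Nat.gcd N ((r - 1) / (q - 1)) = 2)
    (ht : t ^ 2 = r)
    (K F : Type) [Field K] [Fintype K] [Field F] [Fintype F] [Algebra K F]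
    (hcardK : Fintype.card K = q) (hcardF : Fintype.card F = r)
    (α : Fˣ) (hα : ∀ x : Fˣ, x ∈ Subgroup.zpowers α)
    (hθ : ∀ x : F, x ∈ Algebra.adjoin K {((α ^ N : Fˣ) : F)}) :
    (Finset.univ.filter fun β : Fˣ =>
        N * q * codewordWeight K F ((α ^ N : Fˣ) : F) n (β : F) =
          (q - 1) * (r - t)).card = (r - 1) / 2 ∧
    (Finset.univ.filter fun β : Fˣ =>
        N * q * codewordWeight K F ((α ^ N : Fˣ) : F) n (β : F) =
          (q - 1) * (r + t)).card = (r - 1) / 2 := by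
  subst hcardK hcardF
  have hq1 : 1 < Fintype.card K := Fintype.one_lt_card
  have hr1 : 1 < Fintype.card F := Fintype.one_lt_card
  have hdvd : Fintype.card K - 1 ∣ Fintype.card F - 1 := by
    rw [hr]
    simpa using Nat.sub_dvd_pow_sub_pow (Fintype.card K) 1 m
  have hM2 : 2 ∣ (Fintype.card F - 1) / (Fintype.card K - 1) := hN₂ ▸ Nat.gcd_dvd_right _ _
  have hN2 : 2 ∣ N := hN₂ ▸ Nat.gcd_dvd_left _ _
  have heven : 2 ∣ Fintype.card F - 1 := hN2.trans hN
  have hF : ringChar F ≠ 2 := by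
    intro h
    have := FiniteField.even_card_of_char_two h
    omega
  have hNn : N * n = Fintype.card F - 1 := by rw [hn, Nat.mul_div_cancel' hN]
  have hn0 : n ≠ 0 := by
    rintro rfl
    omega
  have hχθ : quadraticChar F ((α ^ N : Fˣ) : F) = 1 := by
    rw [quadraticChar_one_iff_isSquare (Units.ne_zero _), Units.val_pow_eq_pow_val]
    exact (even_iff_two_dvd.2 hN2).isSquare_pow _
  have hθn : ((α ^ N : Fˣ) : F) ^ n = 1 := by
    rw [Units.val_pow_eq_pow_val, ← pow_mul, hNn]
    exact FiniteField.pow_card_sub_one_eq_one _ α.ne_zero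
  obtain ⟨ε, hε, hsum⟩ := exists_sum_quadraticChar_trace (K := K) hF ht fun c hc =>
    quadraticChar_algebraMap_eq_one (by simpa [Nat.card_eq_fintype_card] using hM2) hc
  have hweight : ∀ β : Fˣ,
      ((N * Fintype.card K * codewordWeight K F ((α ^ N : Fˣ) : F) n (β : F) : ℕ) : ℤ) =
        ((Fintype.card K : ℤ) - 1) * (Fintype.card F - ε * quadraticChar F (β : F) * t) := by
    intro β
    have h := sum_pow_eq_sum_quadraticChar (K := K) hF hθn hχθ
      (fun x hx => by
        have hx0 : x ≠ 0 := by
          rintro rfl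
          simp at hx
        exact exists_eq_algebraMap_mul_pow (by simpa [Nat.card_eq_fintype_card] using hN₂) hα hx0
          ((quadraticChar_one_iff_isSquare hx0).1 hx))
      (fun x => if Algebra.trace K F x ≠ 0 then 1 else 0) (by simp)
      (fun c hc x => by simp [← Algebra.smul_def, hc]) (β : F)
    rw [← codewordWeight_eq_sum] at h
    have hNn' : (N : ℂ) * n = Fintype.card F - 1 := by
      rw [← Nat.cast_mul, hNn, Nat.cast_sub hr1.le, Nat.cast_one]
    have hn0' : (n : ℂ) ≠ 0 := by exact_mod_cast hn0
    have key : (N : ℂ) * codewordWeight K F ((α ^ N : Fˣ) : F) n (β : F) =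
        ∑ x : F, (1 + (quadraticChar F x : ℂ)) *
          (if Algebra.trace K F ((β : F) * x) ≠ 0 then 1 else 0) := by
      apply mul_left_cancel₀ hn0'
      rw [← h, ← hNn']
      ring
    have hfin := hsum β β.ne_zero
    rw [← key] at hfin
    have hC : ((N * Fintype.card K * codewordWeight K F ((α ^ N : Fˣ) : F) n (β : F) : ℕ) : ℂ) =
        ((Fintype.card K : ℂ) - 1) * (Fintype.card F - ε * quadraticChar F (β : F) * t) := by
      rw [← hfin]
      push_cast
      ring
    exact_mod_cast hC
  have ht0 : 0 < t := by
    rcases Nat.eq_zero_or_pos t with rfl | h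
    · omega
    · exact h
  have htr : t ≤ Fintype.card F := by nlinarith
  have hεε : ε * ε = 1 := by rcases hε with rfl | rfl <;> norm_num
  have hiff : ∀ (β : Fˣ) (w : ℕ) (δ : ℤ), (δ = 1 ∨ δ = -1) →
      (w : ℤ) = ((Fintype.card K : ℤ) - 1) * (Fintype.card F - δ * t) →
      (N * Fintype.card K * codewordWeight K F ((α ^ N : Fˣ) : F) n (β : F) = w ↔
        quadraticChar F (β : F) = ε * δ) := by
    intro β w δ hδ hw
    have hq0 : (Fintype.card K : ℤ) - 1 ≠ 0 := by omega
    have ht0' : (t : ℤ) ≠ 0 := by omega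
    rw [← Int.natCast_inj, hweight, hw, mul_right_inj' hq0, sub_right_inj, mul_left_inj' ht0']
    constructor
    · intro h
      linear_combination ε * h - quadraticChar F (β : F) * hεε
    · intro h
      rw [h]
      linear_combination δ * hεε
  constructor
  · rw [Finset.filter_congr fun β _ => hiff β _ 1 (Or.inl rfl) (by
      push_cast [Nat.cast_sub hq1.le, Nat.cast_sub htr]; ring)]
    exact card_units_filter_quadraticChar hF (by simpa using hε)
  · rw [Finset.filter_congr fun β _ => hiff β _ (-1) (Or.inr rfl) (by
      push_cast [Nat.cast_sub hq1.le]; ring)]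
    exact card_units_filter_quadraticChar hF (by omega)
end
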